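/- Graphs generated by the AG-generating algorithm induce the marginal and conditional independence model: for an ancestral graph H = (N,F) and pairwise disjoint subsets A, B, C, C₁, M of N, A ⊥_m B | C₁ holds in α_AG(H;M,C) if and only if A ⊥_m B | C∪C₁ holds in H. -/

import Mathlib

/-!
Stable mixed graphs: mixed graphs with arrows, arcs and lines; ribbonless,
summary and ancestral graphs; the generating maps α_RG, α_SG, α_AG;
m-connecting paths, m-separation and induced independence models.
-/

namespace StableMixedGraphs

/-- A mixed graph on node type `V`: a node set together with three edge
relations: arrows (`arrow i j` means an arrow from `i` to `j`), arcs
(two-headed, symmetric) and lines (undirected, symmetric). -/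
structure MixedGraph (V : Type) where
  nodes : Set V
  arrow : V → V → Prop
  arc : V → V → Prop
  line : V → V → Prop

namespace MixedGraph

variable {V W : Type}

/-- Wellformedness: arcs and lines are symmetric relations and all edges join
nodes of the graph. -/
def Wf (G : MixedGraph V) : Prop :=
  (∀ i j, G.arc i j → G.arc j i) ∧
  (∀ i j, G.line i j → G.line j i) ∧
  (∀ i j, G.arrow i j ∨ G.arc i j ∨ G.line i j → i ∈ G.nodes ∧ j ∈ G.nodes)

/-- No loops of any of the three kinds. -/
def Loopless (G : MixedGraph V) : Prop :=
  ∀ i, ¬ G.arrow i i ∧ ¬ G.arc i i ∧ ¬ G.line i i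

/-- A loopless mixed graph with a finite node set. -/
def IsLMG (G : MixedGraph V) : Prop := G.Wf ∧ G.Loopless ∧ G.nodes.Finite

/-- `G.anc i j` : `i` is an ancestor of `j`, i.e. there is a
direction-preserving path from `i` to `j`. -/
def anc (G : MixedGraph V) (i j : V) : Prop := Relation.TransGen G.arrow i j

/-- The set of ancestors of nodes of `C`. -/
def anSet (G : MixedGraph V) (C : Set V) : Set V := {a | ∃ c ∈ C, G.anc a c}

/-- `i` lies on a direction-preserving cycle. -/
def OnDPCycle (G : MixedGraph V) (i : V) : Prop := G.anc i i

/-- `i` is an endpoint of a line. -/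
def LineEndpoint (G : MixedGraph V) (i : V) : Prop := ∃ j, G.line i j

/-- Condition (2) of a ribbon: `i` or a descendant of `i` is an endpoint of a
line or lies on a direction-preserving cycle. -/
def RibbonTail (G : MixedGraph V) (i : V) : Prop :=
  ∃ d, (d = i ∨ G.anc i d) ∧ (G.LineEndpoint d ∨ G.OnDPCycle d)

/-- `G` contains a ribbon: a collider V-configuration `⟨h,i,j⟩` with no
endpoint-identical edge between `h` and `j`, whose inner node `i` (or a
descendant of it) is an endpoint of a line or on a direction-preserving
cycle. -/
def HasRibbon (G : MixedGraph V) : Prop :=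
  ∃ h i j, h ≠ i ∧ i ≠ j ∧ h ≠ j ∧ G.RibbonTail i ∧
    ((G.arc h i ∧ G.arc i j ∧ ¬ G.arc h j) ∨
     (G.arrow h i ∧ G.arrow j i ∧ ¬ G.line h j) ∨
     (G.arrow h i ∧ G.arc i j ∧ ¬ G.arrow h j))

/-- A ribbonless graph: a loopless mixed graph with no ribbon. -/
def IsRG (G : MixedGraph V) : Prop := G.IsLMG ∧ ¬ G.HasRibbon

/-- A directed acyclic graph: only arrows, no direction-preserving cycle. -/
def IsDAG (G : MixedGraph V) : Prop :=
  G.IsLMG ∧ (∀ i j, ¬ G.arc i j) ∧ (∀ i j, ¬ G.line i j) ∧ ∀ i, ¬ G.anc i i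

/-- A summary graph: a loopless mixed graph with no arrowhead pointing to an
endpoint of a line and no direction-preserving cycle. -/
def IsSG (G : MixedGraph V) : Prop :=
  G.IsLMG ∧ (∀ i, G.LineEndpoint i → ∀ k, ¬ G.arrow k i ∧ ¬ G.arc k i) ∧
    ∀ i, ¬ G.anc i i

/-- A simple mixed graph: no loops and no multiple edges. -/
def Simple (G : MixedGraph V) : Prop :=
  G.Loopless ∧ ∀ i j,
    (G.arrow i j → ¬ G.arrow j i ∧ ¬ G.arc i j ∧ ¬ G.line i j) ∧
    (G.arc i j → ¬ G.line i j)

/-- An ancestral graph: a simple mixed graph such that no node is an ancestor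
of one of its parents or spouses, and a node with a neighbour has neither
parents nor spouses. -/
def IsAG (G : MixedGraph V) : Prop :=
  G.Wf ∧ G.Simple ∧ G.nodes.Finite ∧
  (∀ i j, G.arrow j i ∨ G.arc j i → ¬ G.anc i j) ∧
  (∀ i, G.LineEndpoint i → ∀ k, ¬ G.arrow k i ∧ ¬ G.arc k i)

/-- An undirected graph: only lines. -/
def IsUG (G : MixedGraph V) : Prop :=
  G.IsLMG ∧ (∀ i j, ¬ G.arrow i j) ∧ ∀ i j, ¬ G.arc i j

/-- A bidirected graph: only arcs. -/
def IsBG (G : MixedGraph V) : Prop :=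
  G.IsLMG ∧ (∀ i j, ¬ G.arrow i j) ∧ ∀ i j, ¬ G.line i j

/-- Image of a mixed graph under a map of node types. -/
def map (f : V → W) (G : MixedGraph V) : MixedGraph W where
  nodes := f '' G.nodes
  arrow a b := ∃ i j, G.arrow i j ∧ f i = a ∧ f j = b
  arc a b := ∃ i j, G.arc i j ∧ f i = a ∧ f j = b
  line a b := ∃ i j, G.line i j ∧ f i = a ∧ f j = b

end MixedGraph

/-! ### The closure generating new edges (Table 1 of the RG-generating
algorithm), for given marginalisation set `M` and collider set
`S = C ∪ an(C)`.  For every V-configuration whose inner node is a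
non-collider in `M` (rows 1–7) or a collider in `S` (rows 8–10) the
endpoint-identical edge between the endpoints is generated, repeatedly
until closure. -/

mutual
  /-- Generated arrows (`GenArrow H M S j i`: arrow from `j` to `i`). -/
  inductive GenArrow {V : Type} (H : MixedGraph V) (M S : Set V) : V → V → Prop
    | base {i j : V} : H.arrow i j → GenArrow H M S i j
    | row1 {i j m : V} : m ∈ M → j ≠ i →
        GenArrow H M S j m → GenArrow H M S m i → GenArrow H M S j i
    | row2 {i j m : V} : m ∈ M → j ≠ i →
        GenLine H M S j m → GenArrow H M S m i → GenArrow H M S j i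
    | row3 {i j m : V} : m ∈ M → j ≠ i →
        GenLine H M S j m → GenArc H M S m i → GenArrow H M S j i
    | row8 {i j s : V} : s ∈ S → j ≠ i →
        GenArrow H M S j s → GenArc H M S s i → GenArrow H M S j i

  /-- Generated arcs. -/
  inductive GenArc {V : Type} (H : MixedGraph V) (M S : Set V) : V → V → Prop
    | base {i j : V} : H.arc i j → GenArc H M S i j
    | symm {i j : V} : GenArc H M S i j → GenArc H M S j i
    | row4 {i j m : V} : m ∈ M → i ≠ j →
        GenArrow H M S m i → GenArrow H M S m j → GenArc H M S i j
    | row5 {i j m : V} : m ∈ M → i ≠ j →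
        GenArrow H M S m i → GenArc H M S m j → GenArc H M S i j
    | row9 {i j s : V} : s ∈ S → i ≠ j →
        GenArc H M S i s → GenArc H M S s j → GenArc H M S i j

  /-- Generated lines. -/
  inductive GenLine {V : Type} (H : MixedGraph V) (M S : Set V) : V → V → Prop
    | base {i j : V} : H.line i j → GenLine H M S i j
    | symm {i j : V} : GenLine H M S i j → GenLine H M S j i
    | row6 {i j m : V} : m ∈ M → i ≠ j →
        GenLine H M S i m → GenArrow H M S j m → GenLine H M S i j
    | row7 {i j m : V} : m ∈ M → i ≠ j →
        GenLine H M S i m → GenLine H M S m j → GenLine H M S i j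
    | row10 {i j s : V} : s ∈ S → i ≠ j →
        GenArrow H M S i s → GenArrow H M S j s → GenLine H M S i j
end

variable {V : Type}

/-- The RG-generating map `α_RG(H;M,C)`: generate all edges of the closure
and delete the nodes of `M ∪ C`. -/
def alphaRG (H : MixedGraph V) (M C : Set V) : MixedGraph V where
  nodes := H.nodes \ (M ∪ C)
  arrow i j := i ∈ H.nodes \ (M ∪ C) ∧ j ∈ H.nodes \ (M ∪ C) ∧
    GenArrow H M (C ∪ H.anSet C) i j
  arc i j := i ∈ H.nodes \ (M ∪ C) ∧ j ∈ H.nodes \ (M ∪ C) ∧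
    GenArc H M (C ∪ H.anSet C) i j
  line i j := i ∈ H.nodes \ (M ∪ C) ∧ j ∈ H.nodes \ (M ∪ C) ∧
    GenLine H M (C ∪ H.anSet C) i j

/-- The arrowhead-removal operation `α_RG.SG(K;A)`: every arrowhead pointing
at a node of `A` is removed (an arrow at such a node becomes a line, an arc
becomes an arrow, an arc with both endpoints in `A` becomes a line),
repeatedly until closure. -/
def deheadAt (K : MixedGraph V) (A : Set V) : MixedGraph V where
  nodes := K.nodes
  arrow j i := i ∉ A ∧ (K.arrow j i ∨ (K.arc j i ∧ j ∈ A))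
  arc i j := K.arc i j ∧ i ∉ A ∧ j ∉ A
  line i j := K.line i j ∨ (K.arrow j i ∧ i ∈ A) ∨ (K.arrow i j ∧ j ∈ A) ∨
    (K.arc i j ∧ i ∈ A ∧ j ∈ A)

/-- The SG-generating map `α_SG(H;M,C)`: mark the nodes of `an(C)`, apply the
RG-generating construction, then remove all arrowheads pointing at marked
nodes. -/
def alphaSG (H : MixedGraph V) (M C : Set V) : MixedGraph V :=
  deheadAt (alphaRG H M C) (H.anSet C)

/-! ### Step 2 of the AG-generating algorithm: for every V-configuration
`j → k ↔ i` or `j ↔ k ↔ i` with `k ∈ an(i)` (in the current graph) generate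
an arrow from `j` to `i`, respectively an arc between `j` and `i`, until
closure. -/

mutual
  inductive AG2Arrow {V : Type} (K : MixedGraph V) : V → V → Prop
    | base {i j : V} : K.arrow j i → AG2Arrow K j i
    | gen {i j k : V} : j ≠ i → AG2Arrow K j k → AG2Arc K k i →
        AG2Anc K k i → AG2Arrow K j i

  inductive AG2Arc {V : Type} (K : MixedGraph V) : V → V → Prop
    | base {i j : V} : K.arc i j → AG2Arc K i j
    | symm {i j : V} : AG2Arc K i j → AG2Arc K j i
    | gen {i j k : V} : j ≠ i → AG2Arc K j k → AG2Arc K k i →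
        AG2Anc K k i → AG2Arc K j i

  /-- The ancestor relation of the graph being generated in step 2. -/
  inductive AG2Anc {V : Type} (K : MixedGraph V) : V → V → Prop
    | single {i j : V} : AG2Arrow K i j → AG2Anc K i j
    | tail {i k j : V} : AG2Arrow K i k → AG2Anc K k j → AG2Anc K i j
end

/-- The graph after step 2 of the AG-generating algorithm. -/
def ag2 (K : MixedGraph V) : MixedGraph V where
  nodes := K.nodes
  arrow := AG2Arrow K
  arc := AG2Arc K
  line := K.line

/-! ### Step 3 of the AG-generating algorithm: repeatedly replace every arc
between `j` and `i` with `j ∈ an(i)` (in the current graph) by an arrow from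
`j` to `i`. -/

mutual
  inductive AG3Arrow {V : Type} (K : MixedGraph V) : V → V → Prop
    | base {i j : V} : K.arrow j i → AG3Arrow K j i
    | conv {i j : V} : K.arc j i → AG3Anc K j i → AG3Arrow K j i

  /-- The ancestor relation of the graph being generated in step 3. -/
  inductive AG3Anc {V : Type} (K : MixedGraph V) : V → V → Prop
    | single {i j : V} : AG3Arrow K i j → AG3Anc K i j
    | tail {i k j : V} : AG3Arrow K i k → AG3Anc K k j → AG3Anc K i j
end

/-- Steps 2 and 3 of the AG-generating algorithm, applied to a summary
graph: `α_SG.AG`. -/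
def alphaSGAG (K : MixedGraph V) : MixedGraph V :=
  let K2 := ag2 K
  { nodes := K.nodes
    arrow := AG3Arrow K2
    arc := fun i j => K2.arc i j ∧ ¬ AG3Anc K2 i j ∧ ¬ AG3Anc K2 j i
    line := K.line }

/-- The AG-generating map `α_AG(H;M,C)`. -/
def alphaAG (H : MixedGraph V) (M C : Set V) : MixedGraph V :=
  alphaSGAG (alphaSG H M C)

/-! ### Paths, m-connection and m-separation. -/

/-- A step of a walk: it goes from `src` to `tgt` along an edge which has an
arrowhead at `src` iff `hs = true` and an arrowhead at `tgt` iff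
`ht = true` (so `hs = ht = false` is a line, `hs = ht = true` an arc, and
exactly one head an arrow in the corresponding direction). -/
structure Step (V : Type) where
  src : V
  tgt : V
  hs : Bool
  ht : Bool

/-- The edge of a step is present in `G`. -/
def Step.valid (G : MixedGraph V) (s : Step V) : Prop :=
  match s.hs, s.ht with
  | false, false => G.line s.src s.tgt
  | false, true  => G.arrow s.src s.tgt
  | true,  false => G.arrow s.tgt s.src
  | true,  true  => G.arc s.src s.tgt

/-- `w` is a path from `i` to `j` in `G`: a nonempty chained list of valid
steps with no repeated nodes. -/
def IsPath (G : MixedGraph V) (i j : V) (w : List (Step V)) : Prop :=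
  w ≠ [] ∧ (∀ s ∈ w, s.valid G) ∧ List.Chain' (fun a b => a.tgt = b.src) w ∧
    w.head?.map Step.src = some i ∧ w.getLast?.map Step.tgt = some j ∧
    (i :: w.map Step.tgt).Nodup

/-- The path `w` is m-connecting given `M` and `C`: every inner collider node
is in `C ∪ an(C)` and every inner non-collider node is in `M`. -/
def MConnPath (G : MixedGraph V) (M C : Set V) (w : List (Step V)) : Prop :=
  List.Chain'
    (fun a b =>
      (a.ht = true ∧ b.hs = true → a.tgt ∈ C ∪ G.anSet C) ∧
      (¬ (a.ht = true ∧ b.hs = true) → a.tgt ∈ M)) w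

/-- `A ⊥_m B | C` in `G` : there is no m-connecting path between `A` and `B`
given `C` (with `M` the remaining nodes). -/
def MSep (G : MixedGraph V) (A B C : Set V) : Prop :=
  ∀ i ∈ A, ∀ j ∈ B, ∀ w : List (Step V),
    IsPath G i j w → ¬ MConnPath G (G.nodes \ (A ∪ B ∪ C)) C w

/-- The independence model induced by `G` via m-separation: the set of
triples `⟨A,B|C⟩` of pairwise disjoint subsets of the nodes with
`A ⊥_m B | C`. -/
def Jm (G : MixedGraph V) : Set (Set V × Set V × Set V) :=
  {t | t.1 ⊆ G.nodes ∧ t.2.1 ⊆ G.nodes ∧ t.2.2 ⊆ G.nodes ∧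
    Disjoint t.1 t.2.1 ∧ Disjoint t.1 t.2.2 ∧ Disjoint t.2.1 t.2.2 ∧
    MSep G t.1 t.2.1 t.2.2}

/-- The independence model after marginalisation over `M` and conditioning on
`C` : `α(J;M,C)`. -/
def alphaIM (J : Set (Set V × Set V × Set V)) (M C : Set V) :
    Set (Set V × Set V × Set V) :=
  {t | (t.1, t.2.1, t.2.2 ∪ C) ∈ J ∧ (t.1 ∪ t.2.1 ∪ t.2.2) ∩ (M ∪ C) = ∅}

namespace MixedGraph

/-- The edge between `i` and `j` with arrowhead at `i` iff `a` and arrowhead at `j` iff `b`. -/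
def edge (G : MixedGraph V) (i : V) (a : Bool) (j : V) (b : Bool) : Prop :=
  Step.valid G ⟨i, j, a, b⟩

/-- Some arrowhead points to `i`. -/
def HasHead (H : MixedGraph V) (i : V) : Prop := ∃ k, H.arrow k i ∨ H.arc k i

/-- The ancestral information carried by the tail at `i` of an edge between `i` and `j`:
if an arrowhead points to `i` in `H`, then `i` is an ancestor of `j` or of `C`. -/
def TailRel (H : MixedGraph V) (C : Set V) (i j : V) : Prop :=
  H.HasHead i → H.anc i j ∨ i ∈ H.anSet C

/-- Arrowheads and tails of `G` are compatible with the ancestral relations of `H`. -/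
structure Compatible (H : MixedGraph V) (C : Set V) (G : MixedGraph V) : Prop where
  symm : ∀ {i a j b}, G.edge i a j b → G.edge j b i a
  head : ∀ {i j b}, G.edge i true j b → H.HasHead i
  tail : ∀ {i j b}, G.edge i false j b → H.TailRel C i j

variable {H G : MixedGraph V} {C Z : Set V} {i j k : V}

theorem anc.hasHead (h : H.anc i j) : H.HasHead j := by
  obtain ⟨k, -, hk⟩ := Relation.TransGen.tail'_iff.1 h
  exact ⟨k, Or.inl hk⟩

theorem anc.trans (h : H.anc i j) (h' : H.anc j k) : H.anc i k :=
  Relation.TransGen.trans h h'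

theorem anc.anSet (h : H.anc i j) (h' : j ∈ H.anSet C) : i ∈ H.anSet C := by
  obtain ⟨c, hc, h'⟩ := h'
  exact ⟨c, hc, h.trans h'⟩

theorem anc.anSet' (h : H.anc i j) (h' : j ∈ C ∪ H.anSet C) : i ∈ H.anSet C :=
  h'.elim (fun hj => ⟨j, hj, h⟩) h.anSet

theorem anSet_mono (h : C ⊆ Z) : H.anSet C ⊆ H.anSet Z :=
  fun _ ⟨c, hc, hi⟩ => ⟨c, h hc, hi⟩

theorem anSet_union : H.anSet (C ∪ Z) = H.anSet C ∪ H.anSet Z := by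
  ext x
  simp [anSet, or_and_right, exists_or]

theorem TailRel.trans (h : H.TailRel C i j) (h' : H.TailRel C j k) : H.TailRel C i k := by
  intro hi
  rcases h hi with h | h
  · rcases h' h.hasHead with h' | h'
    · exact Or.inl (h.trans h')
    · exact Or.inr (h.anSet h')
  · exact Or.inr h

theorem TailRel.mem_anSet (hac : ∀ i, ¬ H.anc i i) (h : H.TailRel C i j)
    (h' : H.TailRel C j i) (hi : H.HasHead i) : i ∈ H.anSet C := by
  rcases h hi with h | h
  · rcases h' h.hasHead with h' | h'
    · exact absurd (h.trans h') (hac _)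
    · exact h.anSet h'
  · exact h

theorem Step.valid_iff_edge {s : Step V} : s.valid G ↔ G.edge s.src s.hs s.tgt s.ht := Iff.rfl

theorem IsAG.acyclic (hH : H.IsAG) (i : V) : ¬ H.anc i i := by
  intro h
  obtain ⟨k, hk, hki⟩ := Relation.TransGen.tail'_iff.1 h
  rcases Relation.reflTransGen_iff_eq_or_transGen.1 hk with rfl | hk
  · exact (hH.2.1.1 _).1 hki
  · exact hH.2.2.2.1 _ _ (Or.inl hki) hk

theorem IsAG.edge_symm (hH : H.IsAG) {a b : Bool} (h : H.edge i a j b) : H.edge j b i a := by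
  cases a <;> cases b
  · exact hH.1.2.1 _ _ h
  · exact h
  · exact h
  · exact hH.1.1 _ _ h

theorem IsAG.compatible (hH : H.IsAG) (C : Set V) : H.Compatible C H where
  symm := hH.edge_symm
  head {i j b} h := by
    cases b
    · exact ⟨j, Or.inl h⟩
    · exact ⟨j, Or.inr (hH.1.1 _ _ h)⟩
  tail {i j b} h := by
    rintro ⟨k, hk⟩
    cases b
    · have := hH.2.2.2.2 i ⟨j, h⟩ k
      tauto
    · exact Or.inl (Relation.TransGen.single h)

end MixedGraph

open MixedGraph

/-- Consecutive steps of a walk which is connecting given `Z`, with ancestors taken in `H`. -/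
def Link (H : MixedGraph V) (Z : Set V) (s t : Step V) : Prop :=
  s.tgt = t.src ∧ (s.ht = true ∧ t.hs = true → s.tgt ∈ Z ∪ H.anSet Z) ∧
    (¬ (s.ht = true ∧ t.hs = true) → s.tgt ∉ Z)

/-- `w` is a walk in `G` from `A` to `B` which is connecting given `Z`, with ancestors
taken in `H`. -/
structure Connects (H G : MixedGraph V) (Z A B : Set V) (w : List (Step V)) : Prop where
  ne_nil : w ≠ []
  valid : ∀ s ∈ w, s.valid G
  chain : w.IsChain (Link H Z)
  head : ∀ s ∈ w.head?, s.src ∈ A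
  last : ∀ s ∈ w.getLast?, s.tgt ∈ B

open Classical in
/-- The length of a walk, where steps into `M` are counted twice. -/
noncomputable def weight (M : Set V) (w : List (Step V)) : ℕ :=
  (w.map fun s => 1 + if s.tgt ∈ M then 1 else 0).sum

/-- `w` is a connecting walk of least weight. -/
def Shortest (H G : MixedGraph V) (Z A B M : Set V) (w : List (Step V)) : Prop :=
  Connects H G Z A B w ∧ ∀ w', Connects H G Z A B w' → weight M w ≤ weight M w'

section Walks

variable {H G : MixedGraph V} {C Z A B M : Set V} {w l₁ l₂ l₃ : List (Step V)}

theorem weight_append : weight M (l₁ ++ l₂) = weight M l₁ + weight M l₂ := by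
  simp [weight]

theorem weight_pos (h : w ≠ []) : 0 < weight M w := by
  cases w with
  | nil => exact absurd rfl h
  | cons s w => simp only [weight, List.map_cons, List.sum_cons]; omega

theorem Connects.exists_shortest (h : Connects H G Z A B w) (M : Set V) :
    ∃ w, Shortest H G Z A B M w := by
  obtain ⟨w, hw, hmin⟩ := (measure (weight M)).wf.has_min {w | Connects H G Z A B w} ⟨w, h⟩
  exact ⟨w, hw, fun w' hw' => not_lt.1 (hmin w' hw')⟩

/-- A walk leaving a node through a tail leads to a descendant or to an ancestor of `Z`. -/
theorem tail_of_walk (hac : ∀ i, ¬ H.anc i i) (hCZ : C ⊆ Z) (hG : H.Compatible C G) {y : V} :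
    ∀ (w : List (Step V)) (s : Step V), (∀ t ∈ s :: w, t.valid G) →
      (s :: w).IsChain (Link H Z) → (∀ t ∈ (s :: w).getLast?, t.tgt = y) → s.hs = false →
      H.HasHead s.src → s.src ∈ Z ∪ H.anSet Z ∨ H.anc s.src y := by
  intro w
  induction w with
  | nil =>
    intro s hv _ hy hs hh
    have hv := hv s (by simp)
    rw [Step.valid_iff_edge, hs] at hv
    have := hy s (by simp)
    subst this
    exact (hG.tail hv hh).symm.imp_left fun h => Or.inr (anSet_mono hCZ h)
  | cons t w ih =>
    intro s hv hc hy hs hh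
    have hvs := hv s (by simp)
    rw [Step.valid_iff_edge, hs] at hvs
    rw [List.isChain_cons_cons] at hc
    obtain ⟨⟨hst, hcol, -⟩, hc⟩ := hc
    rcases hG.tail hvs hh with h | h
    · by_cases hht : s.ht = true
      · rw [hht] at hvs
        by_cases hths : t.hs = true
        · exact Or.inl (Or.inr (h.anSet' (hcol ⟨hht, hths⟩)))
        · have := ih t (fun u hu => hv u (by simp_all)) hc (by simpa using hy)
            (by simpa using hths) (hst ▸ h.hasHead)
          rw [← hst] at this
          rcases this with h' | h'
          · exact Or.inl (Or.inr (h.anSet' h'))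
          · exact Or.inr (h.trans h')
      · have hvs' := hG.symm hvs
        rw [Bool.not_eq_true] at hht
        rw [hht] at hvs'
        exact Or.inl (Or.inr (anSet_mono hCZ
          ((hG.tail hvs).mem_anSet hac (hG.tail hvs') hh)))
    · exact Or.inl (Or.inr (anSet_mono hCZ h))

/-- A connecting walk of least weight does not return to a node. -/
theorem Shortest.src_ne_tgt (hac : ∀ i, ¬ H.anc i i) (hCZ : C ⊆ Z) (hG : H.Compatible C G)
    (hAB : Disjoint A B) (hw : Shortest H G Z A B M w) (h : w = l₁ ++ l₂ ++ l₃)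
    {s t : Step V} (hs : s ∈ l₂.head?) (ht : t ∈ l₂.getLast?) : s.src ≠ t.tgt := by
  intro hst
  subst h
  have hl₂ : l₂ ≠ [] := by rintro rfl; simp at hs
  obtain ⟨⟨-, hv, hc, hh, hl⟩, hmin⟩ := hw
  rw [List.isChain_append, List.isChain_append] at hc
  obtain ⟨⟨hc₁, hc₂, h₁₂⟩, hc₃, h₂₃⟩ := hc
  have ht' : t ∈ (l₁ ++ l₂).getLast? := by simp_all [List.getLast?_append]
  have hlink : ∀ p ∈ l₁.getLast?, ∀ q ∈ l₃.head?, Link H Z p q := by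
    intro p hp q hq
    obtain ⟨hps, hps₁, hps₂⟩ := h₁₂ p hp s hs
    obtain ⟨htq, htq₁, htq₂⟩ := h₂₃ t ht' q hq
    refine ⟨by rw [hps, hst, htq], ?_, ?_⟩
    · rintro ⟨hp', hq'⟩
      by_cases hs' : s.hs = true
      · exact hps₁ ⟨hp', hs'⟩
      by_cases ht'' : t.ht = true
      · rw [hps, hst]; exact htq₁ ⟨ht'', hq'⟩
      have hpv : p.valid G := hv p (by have := List.mem_of_mem_getLast? hp; simp [this])
      obtain ⟨l, rfl⟩ : ∃ l, l₂ = s :: l := by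
        cases l₂ <;> simp_all
      have hhead : H.HasHead s.src := by
        have := hG.symm (Step.valid_iff_edge.1 hpv)
        rw [hp'] at this
        exact hps ▸ hG.head this
      have := tail_of_walk hac hCZ hG l s (fun u hu => hv u (by simp at hu ⊢; tauto)) hc₂
        (y := s.src) (fun u hu => by
          rw [Option.mem_def] at hu ht
          rw [hst]; congr 1; simpa [ht] using hu.symm) (by simpa using hs') hhead
      rw [hps]
      exact this.resolve_right (hac _)
    · intro hpq hZ
      have h1 := not_not.1 fun h => hps₂ h hZ
      have h2 := not_not.1 fun h => htq₂ h (by rw [← hst, ← hps]; exact hZ)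
      exact hpq ⟨h1.1, h2.2⟩
  have hcon : Connects H G Z A B (l₁ ++ l₃) := by
    refine ⟨?_, fun u hu => hv u (by simp at hu ⊢; tauto), ?_, ?_, ?_⟩
    · intro h0
      obtain ⟨rfl, rfl⟩ := List.append_eq_nil_iff.1 h0
      refine Set.disjoint_left.1 hAB (hh s (by simpa using hs)) ?_
      rw [hst]; exact hl t (by simpa using ht)
    · exact List.isChain_append.2 ⟨hc₁, hc₃, hlink⟩
    · intro u hu
      cases l₁ with
      | nil =>
        have h₁ := (h₂₃ t ht' u (by simpa using hu)).1
        rw [← h₁, ← hst]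
        refine hh s ?_
        cases l₂ <;> simp_all
      | cons p l₁ => exact hh u (by simpa using hu)
    · intro u hu
      by_cases h3 : l₃ = []
      · subst h3
        have h₁ := (h₁₂ u (by simpa using hu) s hs).1
        rw [h₁, hst]
        exact hl t (by simpa using ht')
      · apply hl u
        rw [List.getLast?_append_of_ne_nil _ h3] at hu ⊢
        exact hu
  have h1 := hmin _ hcon
  have h2 := weight_pos (M := M) hl₂
  simp only [weight_append] at h1
  omega

theorem Shortest.inner_notMem (hw : Shortest H G Z A B M w) {s t : Step V}
    (h : w = l₁ ++ s :: t :: l₂) : s.tgt ∉ A ∧ s.tgt ∉ B := by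
  subst h
  obtain ⟨⟨-, hv, hc, hh, hl⟩, hmin⟩ := hw
  have h' : l₁ ++ s :: t :: l₂ = (l₁ ++ [s]) ++ (t :: l₂) := by simp
  rw [h'] at hv hc hh hl hmin
  rw [List.isChain_append] at hc
  obtain ⟨hc₁, hc₂, h₁₂⟩ := hc
  have hst := (h₁₂ s (by simp) t (by simp)).1
  have h1 := weight_pos (M := M) (w := l₁ ++ [s]) (by simp)
  have h2 := weight_pos (M := M) (w := t :: l₂) (by simp)
  rw [weight_append] at hmin
  refine ⟨fun hA => ?_, fun hB => ?_⟩
  · have := hmin (t :: l₂) ⟨by simp, fun u hu => hv u (by simp at hu ⊢; tauto), hc₂,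
      by simpa [← hst] using hA, fun u hu => hl u
        (by rw [List.getLast?_append_of_ne_nil _ (by simp)]; exact hu)⟩
    omega
  · have := hmin (l₁ ++ [s]) ⟨by simp, fun u hu => hv u (by simp at hu ⊢; tauto), hc₁,
      fun u hu => hh u (by cases l₁ <;> simp_all), by simpa using hB⟩
    omega

/-- A segment of a connecting walk of least weight cannot be replaced by an endpoint-identical
segment of smaller weight. -/
theorem Shortest.weight_le (hw : Shortest H G Z A B M w) (h : w = l₁ ++ l₂ ++ l₃)
    {s t s' t' : Step V} (hs : s ∈ l₂.head?) (ht : t ∈ l₂.getLast?) {l : List (Step V)}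
    (hs' : s' ∈ l.head?) (ht' : t' ∈ l.getLast?) (hl : ∀ u ∈ l, u.valid G)
    (hlc : l.IsChain (Link H Z)) (hs₁ : s'.src = s.src) (hs₂ : s'.hs = s.hs)
    (ht₁ : t'.tgt = t.tgt) (ht₂ : t'.ht = t.ht) : weight M l₂ ≤ weight M l := by
  subst h
  obtain ⟨⟨-, hv, hc, hh, hla⟩, hmin⟩ := hw
  rw [List.isChain_append, List.isChain_append] at hc
  obtain ⟨⟨hc₁, hc₂, h₁₂⟩, hc₃, h₂₃⟩ := hc
  have hl₂ : l₂ ≠ [] := by rintro rfl; simp at hs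
  have hl0 : l ≠ [] := by rintro rfl; simp at hs'
  rw [Option.mem_def] at hs hs' ht ht'
  have hcon : Connects H G Z A B (l₁ ++ l ++ l₃) := by
    refine ⟨by simp [hl0], fun u hu => ?_, ?_, ?_, ?_⟩
    · simp only [List.mem_append] at hu hv
      rcases hu with (hu | hu) | hu
      · exact hv u (by tauto)
      · exact hl u hu
      · exact hv u (by tauto)
    · rw [List.isChain_append, List.isChain_append]
      refine ⟨⟨hc₁, hlc, ?_⟩, hc₃, ?_⟩
      · intro p hp q hq
        obtain rfl : s' = q := by simpa [hs'] using hq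
        have := h₁₂ p hp s hs
        simp only [Link] at this ⊢
        rwa [hs₁, hs₂]
      · intro p hp q hq
        rw [List.getLast?_append_of_ne_nil _ hl0] at hp
        obtain rfl : t' = p := by simpa [ht'] using hp
        have := h₂₃ t (by rw [List.getLast?_append_of_ne_nil _ hl₂]; exact ht) q hq
        simp only [Link] at this ⊢
        rwa [ht₁, ht₂]
    · intro u hu
      cases l₁ with
      | nil =>
        have h1 : u = s' := by cases l <;> simp_all
        rw [h1, hs₁]
        exact hh s (by cases l₂ <;> simp_all)
      | cons p l₁ => exact hh u (by simpa using hu)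
    · intro u hu
      by_cases h3 : l₃ = []
      · subst h3
        rw [List.append_nil, List.getLast?_append_of_ne_nil _ hl0, ht'] at hu
        obtain rfl : t' = u := by simpa using hu
        rw [ht₁]
        refine hla t ?_
        rw [List.append_nil, List.getLast?_append_of_ne_nil _ hl₂]
        exact ht
      · apply hla u
        rw [List.getLast?_append_of_ne_nil _ h3] at hu ⊢
        exact hu
  have h1 := hmin _ hcon
  simp only [weight_append] at h1
  omega

/-- In a connecting walk of least weight, no two consecutive steps can be replaced by an
endpoint-identical edge. -/
theorem Shortest.not_edge (hw : Shortest H G Z A B M w) {s t : Step V}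
    (h : w = l₁ ++ s :: t :: l₂) : ¬ G.edge s.src s.hs t.tgt t.ht := by
  intro he
  have := hw.weight_le (l₁ := l₁) (l₂ := [s, t]) (l₃ := l₂) (s := s) (t := t)
    (by simpa using h) (by simp) (by simp) (l := [⟨s.src, t.tgt, s.hs, t.ht⟩])
    (s' := ⟨s.src, t.tgt, s.hs, t.ht⟩) (t' := ⟨s.src, t.tgt, s.hs, t.ht⟩) (by simp) (by simp)
    (fun u hu => by rw [List.mem_singleton.1 hu]; exact he) (by simp) rfl rfl rfl rfl
  simp [weight] at this

theorem nodup_of_src_ne_tgt {R : Step V → Step V → Prop} (hR : ∀ s t, R s t → s.tgt = t.src) :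
    ∀ (w : List (Step V)) (x : V), w.IsChain R → (∀ s ∈ w.head?, s.src = x) →
      (∀ l₁ l₂ l₃, w = l₁ ++ l₂ ++ l₃ → ∀ s ∈ l₂.head?, ∀ t ∈ l₂.getLast?, s.src ≠ t.tgt) →
      (x :: w.map Step.tgt).Nodup := by
  intro w
  induction w with
  | nil => simp
  | cons s w ih =>
    intro x hc hx hne
    rw [List.nodup_cons]
    constructor
    · intro hmem
      obtain ⟨t, ht, htx⟩ := List.mem_map.1 hmem
      obtain ⟨p, q, hpq⟩ := List.append_of_mem ht
      refine hne [] (p ++ [t]) q (by simpa using hpq) s ?_ t (by simp) ?_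
      · cases p <;> simp_all
      · rw [htx]; exact hx s (by simp)
    · rw [List.isChain_cons] at hc
      refine ih s.tgt hc.2 (fun t ht => (hR _ _ (hc.1 t ht)).symm) ?_
      intro l₁ l₂ l₃ h
      exact hne (s :: l₁) l₂ l₃ (by simp [h])

theorem not_mSep_of_shortest (hac : ∀ i, ¬ H.anc i i) (hCZ : C ⊆ Z) (hG : H.Compatible C G)
    (hAB : Disjoint A B) {D : Set V} (hD : D ⊆ Z)
    (hnodes : ∀ {i a j b}, G.edge i a j b → j ∈ G.nodes)
    (hcol : ∀ {i a j}, G.edge i a j true → j ∈ Z ∪ H.anSet Z → j ∈ D ∪ G.anSet D)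
    (hw : Shortest H G Z A B M w) : ¬ MSep G A B D := by
  have hw' := hw
  obtain ⟨⟨hnil, hv, hc, hh, hl⟩, hmin⟩ := hw
  obtain ⟨s, hs⟩ : ∃ s, w.head? = some s := by cases w <;> simp_all
  obtain ⟨t, ht⟩ : ∃ t, w.getLast? = some t := ⟨_, List.getLast?_eq_some_getLast hnil⟩
  intro hsep
  refine hsep s.src (hh s hs) t.tgt (hl t ht) w ⟨hnil, hv, ?_, by simp [hs], by simp [ht], ?_⟩ ?_
  · exact hc.imp fun _ _ h => h.1
  · refine nodup_of_src_ne_tgt (fun _ _ h => h.1) w _ hc (by simp [hs]) ?_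
    intro l₁ l₂ l₃ h u hu v hv
    exact hw'.src_ne_tgt hac hCZ hG hAB h hu hv
  · refine List.isChain_iff_forall_rel_of_append_cons_cons.2 fun a b l₁ l₂ h => ?_
    have hval : G.edge a.src a.hs a.tgt a.ht := hv a (by simp [h])
    have hlink := (List.isChain_iff_forall_rel_of_append_cons_cons.1 hc) h
    refine ⟨fun hab => ?_, fun hab => ⟨hnodes hval, ?_⟩⟩
    · rw [hab.1] at hval
      exact hcol hval (hlink.2.1 hab)
    · have := hw'.inner_notMem h
      have := hlink.2.2 hab
      simp only [Set.mem_union]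
      have := @hD a.tgt
      tauto

end Walks

/-- `Reach G S N i a j b`: there is a walk in `G` from `i` to `j` whose first edge has an
arrowhead at `i` iff `a` and whose last edge has an arrowhead at `j` iff `b`, such that its inner
colliders are in `S` and its inner non-colliders are in `N`. -/
inductive Reach (G : MixedGraph V) (S N : Set V) : V → Bool → V → Bool → Prop
  | edge {i j : V} {a b : Bool} : G.edge i a j b → Reach G S N i a j b
  | snoc {i j k : V} {a b c d : Bool} : Reach G S N i a k b → G.edge k c j d →
      (b = true ∧ c = true → k ∈ S) → (¬ (b = true ∧ c = true) → k ∈ N) → Reach G S N i a j d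

section Reach

variable {H G : MixedGraph V} {C Z A B M S S' N N' : Set V} {i j k x y : V} {a b c d : Bool}

theorem Reach.mono (h : Reach G S N i a j b) (hS : S ⊆ S') (hN : N ⊆ N') :
    Reach G S' N' i a j b := by
  induction h with
  | edge h => exact .edge h
  | snoc _ he h1 h2 ih => exact .snoc ih he (fun h => hS (h1 h)) (fun h => hN (h2 h))

theorem Reach.comp (h : Reach G S N i a k b) (h' : Reach G S N k c j d)
    (hS : b = true ∧ c = true → k ∈ S) (hN : ¬ (b = true ∧ c = true) → k ∈ N) :
    Reach G S N i a j d := by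
  induction h' with
  | edge he => exact .snoc h he hS hN
  | snoc _ he h1 h2 ih => exact .snoc (ih hS hN) he h1 h2

theorem Reach.symm (hG : ∀ {i a j b}, G.edge i a j b → G.edge j b i a)
    (h : Reach G S N i a j b) : Reach G S N j b i a := by
  induction h with
  | edge h => exact .edge (hG h)
  | snoc _ he h1 h2 ih =>
    exact Reach.comp (.edge (hG he)) ih (fun h => h1 h.symm) (fun h => h2 fun h' => h h'.symm)

theorem Reach.hasHead (hG : H.Compatible C G) (h : Reach G S N i a j true) : H.HasHead j := by
  cases h with
  | edge h => exact hG.head (hG.symm h)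
  | snoc _ he _ _ => exact hG.head (hG.symm he)

theorem Reach.exists_connects (h : Reach H (Z ∪ H.anSet Z) Zᶜ x a y b) (hx : x ∈ A)
    (hy : y ∈ B) : ∃ w, Connects H H Z A B w := by
  suffices ∃ w, Connects H H Z A {y} w ∧ ∀ s ∈ w.getLast?, s.ht = b by
    obtain ⟨w, ⟨h1, h2, h3, h4, h5⟩, -⟩ := this
    exact ⟨w, h1, h2, h3, h4, fun s hs => by rw [h5 s hs]; exact hy⟩
  clear hy
  induction h with
  | @edge j a b h =>
    exact ⟨[⟨x, j, a, b⟩], ⟨by simp, fun u hu => by rw [List.mem_singleton.1 hu]; exact h,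
      by simp, by simpa using hx, by simp⟩, by simp⟩
  | @snoc j k a b c d _ he h1 h2 ih =>
    obtain ⟨w, ⟨hn, hv, hc, hh, hl⟩, hb⟩ := ih
    refine ⟨w ++ [⟨k, j, c, d⟩], ⟨by simp, fun u hu => ?_, ?_, fun u hu => ?_, by simp⟩, by simp⟩
    · rcases List.mem_append.1 hu with hu | hu
      · exact hv u hu
      · rw [List.mem_singleton.1 hu]; exact he
    · refine List.isChain_append.2 ⟨hc, by simp, fun p hp q hq => ?_⟩
      obtain rfl : _ = q := by simpa using hq
      have hk : p.tgt = k := hl p hp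
      refine ⟨hk, ?_, ?_⟩
      · rw [hb p hp, hk]; exact h1
      · rw [hb p hp, hk]; exact h2
    · cases w with
      | nil => exact absurd rfl hn
      | cons s w => exact hh u (by simpa using hu)

theorem reach_of_anc (h : H.anc k y) (hk : k ∉ H.anSet Z) :
    Reach H S Zᶜ k false y true := by
  induction h using Relation.TransGen.head_induction_on with
  | single h => exact .edge (a := false) (b := true) h
  | @head k u hku huy ih =>
    have hku' : H.anc k u := Relation.TransGen.single hku
    refine Reach.comp (.edge (a := false) (b := true) hku)
      (ih fun h => hk (hku'.anSet h)) (by simp) fun _ hu => ?_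
    exact hk ⟨u, hu, hku'⟩

/-- Colliders which are ancestors of the endpoints of a walk can be avoided. -/
theorem Reach.of_relaxed (hs : ∀ {i a j b}, H.edge i a j b → H.edge j b i a)
    (h : Reach H (Z ∪ H.anSet Z ∪ {v | H.anc v x ∨ H.anc v y}) Zᶜ x a y b) :
    ∃ a b, Reach H (Z ∪ H.anSet Z) Zᶜ x a y b := by
  suffices (∃ a b, Reach H (Z ∪ H.anSet Z) Zᶜ x a y b) ∨
      ∃ a, Reach H (Z ∪ H.anSet Z) Zᶜ x a y b from this.elim id fun ⟨a, h⟩ => ⟨a, b, h⟩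
  generalize hS : Z ∪ H.anSet Z ∪ {v | H.anc v x ∨ H.anc v y} = S at h
  have key : ∀ {v b}, Reach H S Zᶜ x a v b →
      (∃ a b, Reach H (Z ∪ H.anSet Z) Zᶜ x a y b) ∨
        ∃ a, Reach H (Z ∪ H.anSet Z) Zᶜ x a v b := by
    intro v b h
    clear * - hs h hS
    subst hS
    induction h with
    | edge h => exact Or.inr ⟨_, .edge h⟩
    | @snoc j k a b c d _ he h1 h2 ih =>
      rcases ih with ih | ⟨a', ih⟩
      · exact Or.inl ih
      by_cases hk : k ∈ Z ∪ H.anSet Z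
      · exact Or.inr ⟨a', .snoc ih he (fun _ => hk) h2⟩
      by_cases hbc : b = true ∧ c = true
      · have hkZ : k ∉ H.anSet Z := fun h => hk (Or.inr h)
        rcases (h1 hbc).resolve_left hk with h | h
        · refine Or.inr ⟨true, .snoc ((reach_of_anc h hkZ).symm hs) he (by simp) fun _ h => ?_⟩
          exact hk (Or.inl h)
        · refine Or.inl ⟨a', true, ih.comp (reach_of_anc h hkZ) (by simp) fun _ h => ?_⟩
          exact hk (Or.inl h)
      · exact Or.inr ⟨a', .snoc ih he (fun h => absurd h hbc) h2⟩
  exact key h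

/-- An edge of `G` is represented by a walk in `H` with at least its arrowheads, whose inner
non-colliders are in `M` and whose inner colliders are ancestors of `C` or of its endpoints. -/
def Represented (H : MixedGraph V) (M C : Set V) (i : V) (a : Bool) (j : V) (b : Bool) : Prop :=
  ∃ a' b', (a = true → a' = true) ∧ (b = true → b' = true) ∧
    Reach H (C ∪ H.anSet C ∪ {v | H.anc v i ∨ H.anc v j}) M i a' j b'

theorem Connects.exists_reach (hac : ∀ i, ¬ H.anc i i) (hH : H.Compatible C H) (hCZ : C ⊆ Z)
    (hMZ : Disjoint M Z) (hG : H.Compatible C G)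
    (hrep : ∀ {i a j b}, G.edge i a j b → Represented H M C i a j b)
    {w : List (Step V)} (hw : Connects H G Z A B w) :
    ∃ x ∈ A, ∃ y ∈ B, ∃ a b,
      Reach H (Z ∪ H.anSet Z ∪ {v | H.anc v x ∨ H.anc v y}) Zᶜ x a y b := by
  obtain ⟨hn, hv, hc, hh, hl⟩ := hw
  obtain ⟨s, w, rfl⟩ := List.exists_cons_of_ne_nil hn
  obtain ⟨t, ht⟩ : ∃ t, (s :: w).getLast? = some t := ⟨_, List.getLast?_eq_some_getLast hn⟩
  refine ⟨s.src, hh s (by simp), t.tgt, hl t ht, ?_⟩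
  replace hl : ∀ u ∈ (s :: w).getLast?, u.tgt = t.tgt := by
    intro u hu; rw [ht] at hu; rw [Option.mem_some_iff.1 hu]
  clear hh ht hn
  generalize hx : s.src = x
  generalize t.tgt = y at hl
  set S := Z ∪ H.anSet Z ∪ {v | H.anc v x ∨ H.anc v y} with hS
  have hST : ∀ {u v}, H.anc u v → v ∈ S → u ∈ S := by
    rintro u v huv ((h | h) | h | h)
    · exact Or.inl (Or.inr ⟨v, h, huv⟩)
    · exact Or.inl (Or.inr (huv.anSet h))
    · exact Or.inr (Or.inl (huv.trans h))
    · exact Or.inr (Or.inr (huv.trans h))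
  have hZS : Z ∪ H.anSet Z ⊆ S := Set.subset_union_left
  have hCS : C ∪ H.anSet C ⊆ S := (Set.union_subset_union hCZ (anSet_mono hCZ)).trans hZS
  have hMZ' : M ⊆ Zᶜ := hMZ.subset_compl_right
  have key : ∀ (w : List (Step V)) (s : Step V), (∀ t ∈ s :: w, t.valid G) →
      (s :: w).IsChain (Link H Z) → (∀ t ∈ (s :: w).getLast?, t.tgt = y) →
      (s.src = x ∨ (H.HasHead s.src → s.src ∈ S) ∧ ∃ b,
        (¬ (b = true ∧ s.hs = true) → s.src ∉ Z) ∧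
        ∃ a b', (b = true → b' = true) ∧ Reach H S Zᶜ x a s.src b') →
      ∃ a b, Reach H S Zᶜ x a y b := by
    have extend : ∀ s : Step V, s.valid G → (H.HasHead s.tgt → s.tgt ∈ S ∨ s.tgt = y) →
        (s.src = x ∨ (H.HasHead s.src → s.src ∈ S) ∧ ∃ b,
          (¬ (b = true ∧ s.hs = true) → s.src ∉ Z) ∧
          ∃ a b', (b = true → b' = true) ∧ Reach H S Zᶜ x a s.src b') →
        ∃ a b', (s.ht = true → b' = true) ∧ Reach H S Zᶜ x a s.tgt b' := by
      intro s hvs ht hp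
      obtain ⟨a', b', ha', hb', hr⟩ := hrep hvs
      have hr' : Reach H S Zᶜ s.src a' s.tgt b' := by
        refine hr.mono (Set.union_subset hCS ?_) hMZ'
        rintro v (hv | hv)
        · rcases hp with hp | ⟨hp, -⟩
          · exact Or.inr (Or.inl (hp ▸ hv))
          · exact hST hv (hp hv.hasHead)
        · rcases ht hv.hasHead with h | h
          · exact hST hv h
          · exact Or.inr (Or.inr (h ▸ hv))
      rcases hp with hp | ⟨hp, b, hb, a, b'', hbb, hr''⟩
      · exact ⟨a', b', hb', hp ▸ hr'⟩
      · refine ⟨a, b', hb', hr''.comp hr' (fun h => hp ?_) fun h => hb fun h' => h ?_⟩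
        · obtain rfl := h.1
          exact hr''.hasHead hH
        · exact ⟨hbb h'.1, ha' h'.2⟩
    intro w
    induction w with
    | nil =>
      intro s hv hc hl hp
      obtain ⟨a, b, -, h⟩ := extend s (hv s (by simp)) (fun _ => Or.inr (hl s (by simp))) hp
      rw [hl s (by simp)] at h
      exact ⟨a, b, h⟩
    | cons t w ih =>
      intro s hv hc hl hp
      have hvs : G.edge s.src s.hs s.tgt s.ht := hv s (by simp)
      rw [List.isChain_cons_cons] at hc
      obtain ⟨⟨hst, hcol, hnc⟩, hc⟩ := hc
      have hvt : ∀ u ∈ t :: w, u.valid G := fun u hu => hv u (List.mem_cons_of_mem _ hu)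
      have hlt : ∀ u ∈ (t :: w).getLast?, u.tgt = y := by simpa using hl
      have hQ : H.HasHead s.tgt → s.tgt ∈ S := by
        intro hh
        by_cases hsh : s.ht = true
        · by_cases hth : t.hs = true
          · exact hZS (hcol ⟨hsh, hth⟩)
          · rw [hst] at hh ⊢
            rcases tail_of_walk hac hCZ hG w t hvt hc hlt (by simpa using hth) hh with h | h
            · exact hZS h
            · exact Or.inr (Or.inr h)
        · have hvs' := hG.symm hvs
          rw [Bool.not_eq_true] at hsh
          rw [hsh] at hvs'
          rcases hG.tail hvs' hh with h | h
          · rcases hp with hp | ⟨hp, -⟩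
            · exact Or.inr (Or.inl (hp ▸ h))
            · exact hST h (hp h.hasHead)
          · exact hCS (Or.inr h)
      have := extend s (hv s (by simp)) (fun h => Or.inl (hQ h)) hp
      rw [hst] at this hQ hnc
      exact ih t hvt hc hlt (Or.inr ⟨hQ, s.ht, hnc, this⟩)
  exact key w s hv hc hl (Or.inl hx)

end Reach

/-- The graph of all edges generated by the RG-generating algorithm, before nodes are deleted. -/
def genGraph (H : MixedGraph V) (M C : Set V) : MixedGraph V where
  nodes := H.nodes
  arrow := GenArrow H M (C ∪ H.anSet C)
  arc := GenArc H M (C ∪ H.anSet C)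
  line := GenLine H M (C ∪ H.anSet C)

section Generated

variable {H : MixedGraph V} {M C S : Set V} {P : V → Bool → V → Bool → Prop}

theorem genGraph_edge_symm {i j : V} {a b : Bool} (h : (genGraph H M C).edge i a j b) :
    (genGraph H M C).edge j b i a := by
  cases a <;> cases b
  · exact GenLine.symm h
  · exact h
  · exact h
  · exact GenArc.symm h

theorem genGraph_edge_of_edge {i j : V} {a b : Bool} (h : H.edge i a j b) :
    (genGraph H M C).edge i a j b := by
  cases a <;> cases b
  · exact GenLine.base h
  · exact GenArrow.base h
  · exact GenArrow.base h
  · exact GenArc.base h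

theorem genGraph_edge_of_mem_marg {i j m : V} {a b c d : Bool} (hm : m ∈ M) (hij : i ≠ j)
    (hbc : ¬ (b = true ∧ c = true)) (h : (genGraph H M C).edge i a m b)
    (h' : (genGraph H M C).edge m c j d) : (genGraph H M C).edge i a j d := by
  cases b <;> cases c
  · cases a <;> cases d
    · exact GenLine.row7 hm hij h h'
    · exact GenArrow.row2 hm hij h h'
    · exact GenArrow.row2 hm hij.symm (GenLine.symm h') h
    · exact GenArc.row4 hm hij h h'
  · cases a <;> cases d
    · exact GenLine.row6 hm hij h h'
    · exact GenArrow.row3 hm hij h h'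
    · exact GenArrow.row1 hm hij.symm h' h
    · exact GenArc.row5 hm hij h h'
  · cases a <;> cases d
    · exact GenLine.symm (GenLine.row6 hm hij.symm (GenLine.symm h') h)
    · exact GenArrow.row1 hm hij h h'
    · exact GenArrow.row3 hm hij.symm (GenLine.symm h') (GenArc.symm h)
    · exact GenArc.symm (GenArc.row5 hm hij.symm h' (GenArc.symm h))
  · simp at hbc

theorem genGraph_edge_of_mem_cond {i j m : V} {a d : Bool} (hm : m ∈ C ∪ H.anSet C)
    (hij : i ≠ j) (h : (genGraph H M C).edge i a m true)
    (h' : (genGraph H M C).edge m true j d) : (genGraph H M C).edge i a j d := by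
  cases a <;> cases d
  · exact GenLine.row10 hm hij h h'
  · exact GenArrow.row8 hm hij h h'
  · exact GenArrow.row8 hm hij.symm h' (GenArc.symm h)
  · exact GenArc.row9 hm hij h h'

/-- `P` contains the edges of `H` and is closed under the generation of edges. -/
structure GenClosed (H : MixedGraph V) (M S : Set V) (P : V → Bool → V → Bool → Prop) : Prop where
  base : ∀ {i j a b}, H.edge i a j b → P i a j b
  symm : ∀ {i j a b}, P i a j b → P j b i a
  marg : ∀ {i j m a b c d}, m ∈ M → ¬ (b = true ∧ c = true) → P i a m b → P m c j d →
    P i a j d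
  cond : ∀ {i j m a d}, m ∈ S → P i a m true → P m true j d → P i a j d

mutual

theorem GenArrow.property {i j : V} (hP : GenClosed H M S P) (h : GenArrow H M S i j) :
    P i false j true :=
  match h with
  | .base h => hP.base h
  | .row1 hm _ h h' => hP.marg hm (by simp) (GenArrow.property hP h) (GenArrow.property hP h')
  | .row2 hm _ h h' => hP.marg hm (by simp) (GenLine.property hP h) (GenArrow.property hP h')
  | .row3 hm _ h h' => hP.marg hm (by simp) (GenLine.property hP h) (GenArc.property hP h')
  | .row8 hm _ h h' => hP.cond hm (GenArrow.property hP h) (GenArc.property hP h')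

theorem GenArc.property {i j : V} (hP : GenClosed H M S P) (h : GenArc H M S i j) :
    P i true j true :=
  match h with
  | .base h => hP.base h
  | .symm h => hP.symm (GenArc.property hP h)
  | .row4 hm _ h h' =>
    hP.marg hm (by simp) (hP.symm (GenArrow.property hP h)) (GenArrow.property hP h')
  | .row5 hm _ h h' =>
    hP.marg hm (by simp) (hP.symm (GenArrow.property hP h)) (GenArc.property hP h')
  | .row9 hm _ h h' => hP.cond hm (GenArc.property hP h) (GenArc.property hP h')

theorem GenLine.property {i j : V} (hP : GenClosed H M S P) (h : GenLine H M S i j) :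
    P i false j false :=
  match h with
  | .base h => hP.base h
  | .symm h => hP.symm (GenLine.property hP h)
  | .row6 hm _ h h' =>
    hP.marg hm (by simp) (GenLine.property hP h) (hP.symm (GenArrow.property hP h'))
  | .row7 hm _ h h' => hP.marg hm (by simp) (GenLine.property hP h) (GenLine.property hP h')
  | .row10 hm _ h h' => hP.cond hm (GenArrow.property hP h) (hP.symm (GenArrow.property hP h'))

end

theorem GenClosed.of_edge (hP : GenClosed H M (C ∪ H.anSet C) P) {i j : V} {a b : Bool}
    (h : (genGraph H M C).edge i a j b) : P i a j b := by
  cases a <;> cases b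
  · exact GenLine.property hP h
  · exact GenArrow.property hP h
  · exact hP.symm (GenArrow.property hP h)
  · exact GenArc.property hP h

theorem genGraph_mem_nodes (hH : H.IsAG) {i j : V} {a b : Bool}
    (h : (genGraph H M C).edge i a j b) : i ∈ H.nodes ∧ j ∈ H.nodes := by
  refine GenClosed.of_edge (P := fun i _ j _ => i ∈ H.nodes ∧ j ∈ H.nodes) ?_ h
  refine ⟨fun {i j a b} h => ?_, And.symm, fun _ _ h h' => ⟨h.1, h'.2⟩,
    fun _ h h' => ⟨h.1, h'.2⟩⟩
  cases a <;> cases b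
  · exact hH.1.2.2 i j (Or.inr (Or.inr h))
  · exact hH.1.2.2 i j (Or.inl h)
  · exact (hH.1.2.2 j i (Or.inl h)).symm
  · exact hH.1.2.2 i j (Or.inr (Or.inl h))

theorem genGraph_reach (hH : H.IsAG) {i j : V} {a b : Bool}
    (h : (genGraph H M C).edge i a j b) : Reach H (C ∪ H.anSet C) M i a j b := by
  refine GenClosed.of_edge ?_ h
  exact ⟨Reach.edge, Reach.symm hH.edge_symm, fun hm hbc h h' => h.comp h' (absurd · hbc)
    fun _ => hm, fun hm h h' => h.comp h' (fun _ => hm) (absurd ⟨rfl, rfl⟩)⟩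

theorem genGraph_tailRel (hH : H.IsAG) {i j : V} {a b : Bool}
    (h : (genGraph H M C).edge i a j b) :
    (a = false → H.TailRel C i j) ∧ (b = false → H.TailRel C j i) := by
  have hcond : ∀ {i m j}, m ∈ C ∪ H.anSet C → H.TailRel C i m → H.TailRel C i j :=
    fun hm h hi => Or.inr ((h hi).elim (fun h => h.anSet' hm) id)
  have hmarg : ∀ {i m j : V} {b c d : Bool}, ¬ (b = true ∧ c = true) → H.TailRel C i m →
      (b = false → H.TailRel C m i) → (c = false → H.TailRel C m j) → H.TailRel C i j := by
    intro i m j b c d hbc him hmi hmj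
    cases b
    · exact fun hi => Or.inr (him.mem_anSet hH.acyclic (hmi rfl) hi)
    · exact him.trans (hmj (by simpa using hbc))
  refine GenClosed.of_edge (P := fun i a j b =>
    (a = false → H.TailRel C i j) ∧ (b = false → H.TailRel C j i)) ?_ h
  refine ⟨fun {i j a b} h => ⟨?_, ?_⟩, And.symm, fun _ hbc h h' => ⟨?_, ?_⟩,
    fun hm h h' => ⟨fun ha => hcond hm (h.1 ha), fun hd => hcond hm (h'.2 hd)⟩⟩
  · rintro rfl
    exact (hH.compatible C).tail h
  · rintro rfl
    exact (hH.compatible C).tail (hH.edge_symm h)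
  · exact fun ha => hmarg (d := true) hbc (h.1 ha) h.2 h'.1
  · exact fun hd => hmarg (d := true) (fun h => hbc h.symm) (h'.2 hd) h'.1 h.2

theorem genGraph_compatible (hH : H.IsAG) : H.Compatible C (genGraph H M C) where
  symm := genGraph_edge_symm
  head h := ((genGraph_reach hH h).symm hH.edge_symm).hasHead (hH.compatible C)
  tail h := (genGraph_tailRel hH h).1 rfl

/-- The edges generated by the algorithm after arrowheads at ancestors of `C` are removed. -/
structure AncestralEdge (H : MixedGraph V) (M C : Set V) (i : V) (a : Bool) (j : V)
    (b : Bool) : Prop where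
  mem_left : i ∈ H.nodes \ (M ∪ C)
  mem_right : j ∈ H.nodes \ (M ∪ C)
  head_left : a = true → i ∉ H.anSet C
  head_right : b = true → j ∉ H.anSet C
  tail_left : a = false → H.TailRel C i j
  tail_right : b = false → H.TailRel C j i
  represented : Represented H M C i a j b

variable {i j k : V} {a b : Bool}

theorem AncestralEdge.symm (hH : H.IsAG) (h : AncestralEdge H M C i a j b) :
    AncestralEdge H M C j b i a := by
  obtain ⟨h1, h2, h3, h4, h5, h6, a', b', ha, hb, h7⟩ := h
  refine ⟨h2, h1, h4, h3, h6, h5, b', a', hb, ha, ?_⟩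
  exact (h7.symm hH.edge_symm).mono (Set.union_subset_union_right _ fun v hv => Or.symm hv) le_rfl

theorem AncestralEdge.hasHead (hH : H.IsAG) (h : AncestralEdge H M C i a j true) :
    H.HasHead j := by
  obtain ⟨a', b', -, hb, h⟩ := h.represented
  obtain rfl := hb rfl
  exact h.hasHead (hH.compatible C)

theorem AncestralEdge.tail (h : AncestralEdge H M C i a j b) (hij : H.TailRel C i j) :
    AncestralEdge H M C i false j b := by
  obtain ⟨h1, h2, h3, h4, h5, h6, a', b', ha, hb, h7⟩ := h
  exact ⟨h1, h2, by simp, h4, fun _ => hij, h6, a', b', by simp, hb, h7⟩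

theorem AncestralEdge.comp (hH : H.IsAG) (h : AncestralEdge H M C j a k true)
    (h' : AncestralEdge H M C k true i true) (hki : H.TailRel C k i) :
    AncestralEdge H M C j a i true := by
  have hk := (hki (h.hasHead hH)).resolve_right (h.head_right rfl)
  obtain ⟨a', c', ha, hc, hr⟩ := h.represented
  obtain ⟨d', b', hd, hb, hr'⟩ := h'.represented
  obtain rfl := hc rfl
  obtain rfl := hd rfl
  refine ⟨h.mem_left, h'.mem_right, h.head_left, h'.head_right,
    fun ha => (h.tail_left ha).trans hki,
    by simp, a', b', ha, hb, ?_⟩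
  refine Reach.comp (k := k) (hr.mono ?_ le_rfl) (hr'.mono ?_ le_rfl)
    (fun _ => Or.inr (Or.inr hk)) (absurd ⟨rfl, rfl⟩)
  · exact Set.union_subset_union_right _ fun v hv => hv.imp id fun h => h.trans hk
  · exact Set.union_subset_union_right _ fun v hv => Or.inr (hv.elim (fun h => h.trans hk) id)

theorem AncestralEdge.of_genGraph (hH : H.IsAG) {a' b' : Bool}
    (h : (genGraph H M C).edge i a j b) (hi : i ∈ H.nodes \ (M ∪ C))
    (hj : j ∈ H.nodes \ (M ∪ C)) (ha : a' = true → a = true ∧ i ∉ H.anSet C)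
    (hb : b' = true → b = true ∧ j ∉ H.anSet C) (ha' : a' = false → a = false ∨ i ∈ H.anSet C)
    (hb' : b' = false → b = false ∨ j ∈ H.anSet C) : AncestralEdge H M C i a' j b' :=
  have h' := genGraph_tailRel hH h
  ⟨hi, hj, fun h => (ha h).2, fun h => (hb h).2,
    fun h => (ha' h).elim h'.1 fun h _ => Or.inr h,
    fun h => (hb' h).elim h'.2 fun h _ => Or.inr h, a, b, fun h => (ha h).1, fun h => (hb h).1,
    (genGraph_reach hH h).mono Set.subset_union_left le_rfl⟩

theorem alphaSG_ancestralEdge (hH : H.IsAG) (h : (alphaSG H M C).edge i a j b) :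
    AncestralEdge H M C i a j b := by
  have harrow : ∀ {i j : V}, (alphaSG H M C).arrow i j → AncestralEdge H M C i false j true := by
    rintro i j ⟨hj', ⟨hi, hj, h⟩ | ⟨⟨hi, hj, h⟩, hi'⟩⟩
    · exact .of_genGraph (a := false) (b := true) hH h hi hj (by simp) (by simp [hj']) (by simp)
        (by simp)
    · exact .of_genGraph (a := true) (b := true) hH h hi hj (by simp) (by simp [hj'])
        (by simp [hi']) (by simp)
  cases a <;> cases b
  · rcases h with ⟨hi, hj, h⟩ | ⟨⟨hj, hi, h⟩, hi'⟩ | ⟨⟨hi, hj, h⟩, hj'⟩ | ⟨⟨hi, hj, h⟩, hi', hj'⟩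
    · exact .of_genGraph (a := false) (b := false) hH h hi hj (by simp) (by simp) (by simp)
        (by simp)
    · exact .of_genGraph (a := true) (b := false) hH h hi hj (by simp) (by simp) (by simp [hi'])
        (by simp)
    · exact .of_genGraph (a := false) (b := true) hH h hi hj (by simp) (by simp) (by simp)
        (by simp [hj'])
    · exact .of_genGraph (a := true) (b := true) hH h hi hj (by simp) (by simp) (by simp [hi'])
        (by simp [hj'])
  · exact harrow h
  · exact (harrow h).symm hH
  · obtain ⟨⟨hi, hj, h⟩, hi', hj'⟩ := h
    exact .of_genGraph (a := true) (b := true) hH h hi hj (by simp [hi']) (by simp [hj']) (by simp)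
      (by simp)

end Generated

theorem AG2Anc.trans {K : MixedGraph V} {i j k : V} (h : AG2Anc K i j) (h' : AG2Anc K j k) :
    AG2Anc K i k :=
  match h with
  | .single h => .tail h h'
  | .tail h h₂ => .tail h (AG2Anc.trans h₂ h')

mutual

theorem AG3Arrow.ag2Anc {K : MixedGraph V} {i j : V} (h : AG3Arrow (ag2 K) i j) :
    AG2Anc K i j :=
  match h with
  | .base h => .single h
  | .conv _ h => AG3Anc.ag2Anc h

theorem AG3Anc.ag2Anc {K : MixedGraph V} {i j : V} (h : AG3Anc (ag2 K) i j) : AG2Anc K i j :=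
  match h with
  | .single h => AG3Arrow.ag2Anc h
  | .tail h h' => (AG3Arrow.ag2Anc h).trans (AG3Anc.ag2Anc h')

end

section Ancestral

variable {H : MixedGraph V} {M C : Set V} {i j k : V} {a b : Bool}

mutual

theorem AG2Arrow.ancestralEdge {i j : V} (hH : H.IsAG) (h : AG2Arrow (alphaSG H M C) j i) :
    AncestralEdge H M C j false i true :=
  match h with
  | .base h => alphaSG_ancestralEdge hH h
  | .gen _ h h' hki => (AG2Arrow.ancestralEdge hH h).comp hH (AG2Arc.ancestralEdge hH h')
      (AG2Anc.tailRel hH hki)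

theorem AG2Arc.ancestralEdge {i j : V} (hH : H.IsAG) (h : AG2Arc (alphaSG H M C) j i) :
    AncestralEdge H M C j true i true :=
  match h with
  | .base h => alphaSG_ancestralEdge hH h
  | .symm h => (AG2Arc.ancestralEdge hH h).symm hH
  | .gen _ h h' hki => (AG2Arc.ancestralEdge hH h).comp hH (AG2Arc.ancestralEdge hH h')
      (AG2Anc.tailRel hH hki)

theorem AG2Anc.tailRel {i j : V} (hH : H.IsAG) (h : AG2Anc (alphaSG H M C) j i) : H.TailRel C j i :=
  match h with
  | .single h => (AG2Arrow.ancestralEdge hH h).tail_left rfl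
  | .tail h h' => ((AG2Arrow.ancestralEdge hH h).tail_left rfl).trans (AG2Anc.tailRel hH h')

end

theorem alphaSG_line_symm (h : (alphaSG H M C).line i j) :
    (alphaSG H M C).line j i := by
  have hline : ∀ {i j}, (alphaRG H M C).line i j → (alphaRG H M C).line j i :=
    fun h => ⟨h.2.1, h.1, h.2.2.symm⟩
  have harc : ∀ {i j}, (alphaRG H M C).arc i j → (alphaRG H M C).arc j i :=
    fun h => ⟨h.2.1, h.1, h.2.2.symm⟩
  rcases h with h | h | h | ⟨h, h1, h2⟩
  · exact Or.inl (hline h)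
  · exact Or.inr (Or.inr (Or.inl h))
  · exact Or.inr (Or.inl h)
  · exact Or.inr (Or.inr (Or.inr ⟨harc h, h2, h1⟩))

theorem ag2_ancestralEdge (hH : H.IsAG) (h : (ag2 (alphaSG H M C)).edge i a j b) :
    AncestralEdge H M C i a j b := by
  cases a <;> cases b
  · exact alphaSG_ancestralEdge hH h
  · exact AG2Arrow.ancestralEdge hH h
  · exact (AG2Arrow.ancestralEdge hH h).symm hH
  · exact AG2Arc.ancestralEdge hH h

theorem alphaAG_ancestralEdge (hH : H.IsAG) (h : (alphaAG H M C).edge i a j b) :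
    AncestralEdge H M C i a j b := by
  have harrow : ∀ {i j : V}, (alphaAG H M C).arrow i j → AncestralEdge H M C i false j true := by
    rintro i j (h | ⟨h, hij⟩)
    · exact AG2Arrow.ancestralEdge hH h
    · exact (AG2Arc.ancestralEdge hH h).tail (hij.ag2Anc.tailRel hH)
  cases a <;> cases b
  · exact alphaSG_ancestralEdge hH h
  · exact harrow h
  · exact (harrow h).symm hH
  · exact AG2Arc.ancestralEdge hH h.1

theorem ag2_compatible (hH : H.IsAG) : H.Compatible C (ag2 (alphaSG H M C)) where
  symm {i a j b} h := by
    cases a <;> cases b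
    · exact alphaSG_line_symm h
    · exact h
    · exact h
    · exact AG2Arc.symm h
  head h := ((ag2_ancestralEdge hH h).symm hH).hasHead hH
  tail h := (ag2_ancestralEdge hH h).tail_left rfl

theorem alphaAG_compatible (hH : H.IsAG) : H.Compatible C (alphaAG H M C) where
  symm {i a j b} h := by
    cases a <;> cases b
    · exact alphaSG_line_symm h
    · exact h
    · exact h
    · exact ⟨AG2Arc.symm h.1, h.2.2, h.2.1⟩
  head h := ((alphaAG_ancestralEdge hH h).symm hH).hasHead hH
  tail h := (alphaAG_ancestralEdge hH h).tail_left rfl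

theorem alphaAG_tailRel_of_anc (hH : H.IsAG) (h : (alphaAG H M C).anc i j) :
    H.TailRel C i j := by
  induction h with
  | single h => exact (alphaAG_ancestralEdge (a := false) (b := true) hH h).tail_left rfl
  | tail _ h ih =>
    exact ih.trans ((alphaAG_ancestralEdge (a := false) (b := true) hH h).tail_left rfl)

theorem alphaAG_arrow_of_genArrow (h : GenArrow H M (C ∪ H.anSet C) i j)
    (hi : i ∈ H.nodes \ (M ∪ C)) (hj : j ∈ H.nodes \ (M ∪ C)) (hjC : j ∉ H.anSet C) :
    (alphaAG H M C).arrow i j :=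
  .base (.base ⟨hjC, Or.inl ⟨hi, hj, h⟩⟩)

/-- A directed path in `H` to a remaining node `c` yields a generated arrow to the first
remaining node on it. -/
theorem exists_genArrow_of_anc (hH : H.IsAG) {c : V} (hc : c ∈ H.nodes \ (M ∪ C))
    (h : H.anc k c) (hk : k ∉ H.anSet C) :
    ∃ d ∈ H.nodes \ (M ∪ C), GenArrow H M (C ∪ H.anSet C) k d ∧ H.anc k d ∧
      (d = c ∨ H.anc d c) ∧ (d = c ∨ (alphaAG H M C).anc d c) := by
  induction h using Relation.TransGen.head_induction_on with
  | single h => exact ⟨c, hc, .base h, .single h, Or.inl rfl, Or.inl rfl⟩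
  | @head k u hku huc ih =>
    have hku' : H.anc k u := .single hku
    obtain ⟨d, hd, hud, hud', hdc, hdc'⟩ := ih fun h => hk (hku'.anSet h)
    have hkd : H.anc k d := hku'.trans hud'
    by_cases hu : u ∈ M
    · refine ⟨d, hd, .row1 hu ?_ (.base hku) hud, hkd, hdc, hdc'⟩
      rintro rfl
      exact hH.acyclic _ hkd
    · have hu' : u ∈ H.nodes \ (M ∪ C) :=
        ⟨(hH.1.2.2 k u (Or.inl hku)).2, fun h => h.elim hu fun h => hk ⟨u, h, hku'⟩⟩
      have harrow := alphaAG_arrow_of_genArrow hud hu' hd fun h => hk (hkd.anSet h)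
      refine ⟨u, hu', .base hku, hku', Or.inr huc, Or.inr ?_⟩
      rcases hdc' with rfl | hdc'
      · exact .single harrow
      · exact .head harrow hdc'

end Ancestral

section Transfer

variable {H G G' : MixedGraph V} {A B C C₁ D M N Z : Set V} {i j k : V} {a b a' b' : Bool}
  {w l₁ l₂ : List (Step V)} {s t : Step V}

theorem Connects.of_isPath (hp : IsPath G i j w) (hc : MConnPath G N D w) (hi : i ∈ A)
    (hj : j ∈ B) (hN : N ⊆ Zᶜ)
    (hcol : ∀ {i a j}, G.edge i a j true → j ∈ D ∪ G.anSet D → j ∈ Z ∪ H.anSet Z) :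
    Connects H G Z A B w := by
  obtain ⟨hnil, hv, hch, hh, hl, -⟩ := hp
  refine ⟨hnil, hv, ?_, fun s hs => ?_, fun s hs => ?_⟩
  · refine List.isChain_iff_forall_rel_of_append_cons_cons.2 fun s t l₁ l₂ h => ?_
    have h1 := (List.isChain_iff_forall_rel_of_append_cons_cons.1 hch) h
    have h2 := (List.isChain_iff_forall_rel_of_append_cons_cons.1 hc) h
    have hval : G.edge s.src s.hs s.tgt s.ht := hv s (by simp [h])
    refine ⟨h1, fun hst => ?_, fun hst => hN (h2.2 hst)⟩
    rw [hst.1] at hval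
    exact hcol hval (h2.1 hst)
  · rw [Option.mem_def] at hs
    simp only [hs, Option.map_some, Option.some.injEq] at hh
    rwa [hh]
  · rw [Option.mem_def] at hs
    simp only [hs, Option.map_some, Option.some.injEq] at hl
    rwa [hl]

theorem Connects.forall_mem (hw : Connects H G Z A B w) (hA : A ⊆ N) (hB : B ⊆ N)
    (hN : ∀ {l₁ l₂ s t}, w = l₁ ++ s :: t :: l₂ → s.tgt ∈ N) :
    ∀ s ∈ w, s.src ∈ N ∧ s.tgt ∈ N := by
  intro s hs
  obtain ⟨p, q, rfl⟩ := List.append_of_mem hs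
  constructor
  · rcases List.eq_nil_or_concat' p with rfl | ⟨p, r, rfl⟩
    · exact hA (hw.head s (by simp))
    · have h : p ++ [r] ++ s :: q = p ++ r :: s :: q := by simp
      rw [← ((List.isChain_iff_forall_rel_of_append_cons_cons.1 hw.chain) h).1]
      exact hN h
  · cases q with
    | nil => exact hB (hw.last s (by simp))
    | cons t q => exact hN rfl

/-- Arrowheads along a walk may be changed as long as this affects no collider. -/
theorem Connects.map (hw : Connects H G Z A B w) {f : Step V → Step V}
    (hsrc : ∀ s, (f s).src = s.src) (htgt : ∀ s, (f s).tgt = s.tgt)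
    (hv : ∀ s ∈ w, (f s).valid G')
    (hf : ∀ {l₁ l₂ s t}, w = l₁ ++ s :: t :: l₂ →
      (((f s).ht = true ∧ (f t).hs = true) ↔ (s.ht = true ∧ t.hs = true))) :
    Connects H G' Z A B (w.map f) := by
  refine ⟨by simpa using hw.ne_nil, by simpa using hv, ?_, fun s hs => ?_, fun s hs => ?_⟩
  · rw [List.isChain_map]
    refine List.isChain_iff_forall_rel_of_append_cons_cons.2 fun s t l₁ l₂ h => ?_
    have := (List.isChain_iff_forall_rel_of_append_cons_cons.1 hw.chain) h
    rwa [Link, hf h, hsrc, htgt]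
  · rw [List.head?_map] at hs
    obtain ⟨u, hu, rfl⟩ := Option.map_eq_some_iff.1 hs
    rw [hsrc]
    exact hw.head u hu
  · rw [List.getLast?_map] at hs
    obtain ⟨u, hu, rfl⟩ := Option.map_eq_some_iff.1 hs
    rw [htgt]
    exact hw.last u hu

open Classical in
/-- Remove the arrowheads of a step at those endpoints which are `P`-related to the other one. -/
noncomputable def Step.dehead (P : V → V → Prop) (s : Step V) : Step V :=
  ⟨s.src, s.tgt, decide (s.hs = true ∧ ¬ P s.src s.tgt), decide (s.ht = true ∧ ¬ P s.tgt s.src)⟩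

theorem Connects.dehead (hw : Connects H G Z A B w) {P : V → V → Prop}
    (hv : ∀ {s a b}, s ∈ w → (a = true ↔ s.hs = true ∧ ¬ P s.src s.tgt) →
      (b = true ↔ s.ht = true ∧ ¬ P s.tgt s.src) → G'.edge s.src a s.tgt b)
    (hP : ∀ {l₁ l₂ s t}, w = l₁ ++ s :: t :: l₂ → s.tgt = t.src → s.ht = true → t.hs = true →
      ¬ P s.tgt s.src ∧ ¬ P t.src t.tgt) :
    Connects H G' Z A B (w.map (Step.dehead P)) := by
  refine hw.map (fun _ => rfl) (fun _ => rfl) (fun s hs => ?_) (fun {l₁ l₂ s t} h => ?_)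
  · exact hv hs (by simp) (by simp)
  · have hst := ((List.isChain_iff_forall_rel_of_append_cons_cons.1 hw.chain) h).1
    have := hP h hst
    simp only [Step.dehead, decide_eq_true_eq]
    tauto

theorem alphaSG_edge_of_genGraph (h : (genGraph H M C).edge i a j b)
    (hi : i ∈ H.nodes \ (M ∪ C)) (hj : j ∈ H.nodes \ (M ∪ C))
    (ha : a' = true ↔ a = true ∧ i ∉ H.anSet C) (hb : b' = true ↔ b = true ∧ j ∉ H.anSet C) :
    (alphaSG H M C).edge i a' j b' := by
  have hsymm : (genGraph H M C).edge j b i a := genGraph_edge_symm h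
  by_cases hi' : i ∈ H.anSet C <;> by_cases hj' : j ∈ H.anSet C <;>
    cases a <;> cases b <;> simp [hi', hj'] at ha hb <;> subst ha hb <;>
    simp only [edge, Step.valid, alphaSG, deheadAt, alphaRG, genGraph] at h hsymm ⊢ <;> tauto

theorem ag2_edge_of_alphaSG (h : (alphaSG H M C).edge i a j b) :
    (ag2 (alphaSG H M C)).edge i a j b := by
  cases a <;> cases b
  · exact h
  · exact AG2Arrow.base h
  · exact AG2Arrow.base h
  · exact AG2Arc.base h

/-- The edges generated in the second step of the algorithm. -/
theorem ag2_edge_of_ag2Anc (hH : H.IsAG) (hij : i ≠ j)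
    (h : (ag2 (alphaSG H M C)).edge i a k true) (h' : (ag2 (alphaSG H M C)).edge k true j b)
    (hki : AG2Anc (alphaSG H M C) k i) : (ag2 (alphaSG H M C)).edge i a j b := by
  cases a
  · have he := ag2_ancestralEdge hH h
    exact absurd ((hki.tailRel hH).mem_anSet hH.acyclic (he.tail_left rfl) (he.hasHead hH))
      (he.head_right rfl)
  · cases b
    · exact AG2Arrow.gen hij.symm h' (AG2Arc.symm h) hki
    · exact AG2Arc.symm (AG2Arc.gen hij.symm (AG2Arc.symm h') (AG2Arc.symm h) hki)

theorem alphaAG_edge_of_ag2 (hH : H.IsAG) (h : (ag2 (alphaSG H M C)).edge i a j b)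
    (ha : a' = true ↔ a = true ∧ ¬ AG3Anc (ag2 (alphaSG H M C)) i j)
    (hb : b' = true ↔ b = true ∧ ¬ AG3Anc (ag2 (alphaSG H M C)) j i) :
    (alphaAG H M C).edge i a' j b' := by
  have key : ∀ {i j b}, (ag2 (alphaSG H M C)).edge i true j b →
      AG3Anc (ag2 (alphaSG H M C)) i j → ¬ H.TailRel C j i := by
    intro i j b h hij hji
    have he := (ag2_ancestralEdge hH h).symm hH
    exact he.head_right rfl ((hij.ag2Anc.tailRel hH).mem_anSet hH.acyclic hji (he.hasHead hH))
  have hsymm := (ag2_compatible hH).symm h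
  cases a <;> cases b
  · obtain rfl : a' = false := by simpa using ha
    obtain rfl : b' = false := by simpa using hb
    exact h
  · obtain rfl : a' = false := by simpa using ha
    obtain rfl : b' = true :=
      hb.2 ⟨rfl, fun h' => key hsymm h' ((ag2_ancestralEdge hH h).tail_left rfl)⟩
    exact AG3Arrow.base h
  · obtain rfl : b' = false := by simpa using hb
    obtain rfl : a' = true :=
      ha.2 ⟨rfl, fun h' => key h h' ((ag2_ancestralEdge hH h).tail_right rfl)⟩
    exact AG3Arrow.base h
  · by_cases hij : AG3Anc (ag2 (alphaSG H M C)) i j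
    · have hji : ¬ AG3Anc (ag2 (alphaSG H M C)) j i := fun h' =>
        key h hij (h'.ag2Anc.tailRel hH)
      obtain rfl : a' = false := by simpa [hij] using ha
      obtain rfl : b' = true := hb.2 ⟨rfl, hji⟩
      exact AG3Arrow.conv h hij
    · obtain rfl : a' = true := ha.2 ⟨rfl, hij⟩
      by_cases hji : AG3Anc (ag2 (alphaSG H M C)) j i
      · obtain rfl : b' = false := by simpa [hji] using hb
        exact AG3Arrow.conv hsymm hji
      · obtain rfl : b' = true := hb.2 ⟨rfl, hji⟩
        exact ⟨h, hij, hji⟩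

/-- In a connecting walk of least weight, all inner nodes remain after marginalisation and
conditioning, and no collider is an ancestor of `C`. -/
theorem Shortest.inner_notMem_of_genGraph (hH : H.IsAG) (hC₁ : C₁ ⊆ H.nodes) (hAB : Disjoint A B)
    (hCC₁ : Disjoint C C₁) (hC₁M : Disjoint C₁ M)
    (hw : Shortest H (genGraph H M C) (C ∪ C₁) A B M w) (h : w = l₁ ++ s :: t :: l₂) :
    s.tgt ∉ M ∪ C ∧ (s.ht = true ∧ t.hs = true → s.tgt ∉ H.anSet C) := by
  have hne : s.src ≠ t.tgt := hw.src_ne_tgt hH.acyclic Set.subset_union_left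
    (genGraph_compatible hH) hAB (l₁ := l₁) (l₂ := [s, t]) (l₃ := l₂) (by simpa using h)
    (by simp) (by simp)
  have hno := hw.not_edge h
  obtain ⟨hst, hcol, hnon⟩ := (List.isChain_iff_forall_rel_of_append_cons_cons.1 hw.1.chain) h
  have hs : (genGraph H M C).edge s.src s.hs s.tgt s.ht := hw.1.valid s (by simp [h])
  have ht : (genGraph H M C).edge t.src t.hs t.tgt t.ht := hw.1.valid t (by simp [h])
  rw [← hst] at ht
  by_cases hc : s.ht = true ∧ t.hs = true
  · have hcol := hcol hc
    obtain ⟨hc₁, hc₂⟩ := hc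
    rw [hc₁] at hs
    rw [hc₂] at ht
    have hkC : s.tgt ∉ C ∪ H.anSet C := fun hk => hno (genGraph_edge_of_mem_cond hk hne hs ht)
    refine ⟨fun hk => ?_, fun _ hk => hkC (Or.inr hk)⟩
    have hkM : s.tgt ∈ M := hk.resolve_right fun hk => hkC (Or.inl hk)
    have hkC' : s.tgt ∉ H.anSet C := fun hk => hkC (Or.inr hk)
    have hk₁ : s.tgt ∈ H.anSet C₁ := by
      rw [anSet_union] at hcol
      have := hC₁M.notMem_of_mem_right hkM
      simp only [Set.mem_union] at hcol hkC
      tauto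
    obtain ⟨c, hc, hkc⟩ := hk₁
    obtain ⟨d, hd, hgen, hkd, hdc, -⟩ := exists_genArrow_of_anc hH
      ⟨hC₁ hc, not_or.2 ⟨hC₁M.notMem_of_mem_left hc, hCC₁.notMem_of_mem_right hc⟩⟩ hkc hkC'
    have hkd' : (genGraph H M C).edge s.tgt false d true := hgen
    have htail : ∀ {b}, ¬ (genGraph H M C).edge d false s.tgt b := fun he =>
      hkC' ((((genGraph_tailRel hH he).1 rfl) hkd.hasHead).elim
        (fun h => absurd (h.trans hkd) (hH.acyclic _)) hkd.anSet)
    by_cases hid : s.src = d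
    · subst hid
      cases hs' : s.hs with
      | false => exact htail (hs' ▸ hs)
      | true =>
        rw [hs'] at hno
        exact hno (genGraph_edge_of_mem_marg hkM hne (by simp) (genGraph_edge_symm hkd') ht)
    by_cases hjd : t.tgt = d
    · subst hjd
      cases ht' : t.ht with
      | false => exact htail (genGraph_edge_symm (ht' ▸ ht))
      | true =>
        rw [ht'] at hno
        exact hno (genGraph_edge_of_mem_marg hkM hne (by simp) hs hkd')
    have h1 := genGraph_edge_of_mem_marg hkM hid (by simp) hs hkd'
    have h2 := genGraph_edge_of_mem_marg hkM (Ne.symm hjd) (by simp) (genGraph_edge_symm hkd') ht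
    have hle := hw.weight_le (l₁ := l₁) (l₂ := [s, t]) (l₃ := l₂) (s := s) (t := t)
      (by simpa using h) (by simp) (by simp) (s' := ⟨s.src, d, s.hs, true⟩)
      (t' := ⟨d, t.tgt, true, t.ht⟩) (l := [⟨s.src, d, s.hs, true⟩, ⟨d, t.tgt, true, t.ht⟩])
      (by simp) (by simp) ?_ ?_ rfl rfl rfl rfl
    · have hdM : d ∉ M := fun h => hd.2 (Or.inl h)
      simp [weight, hkM, hdM] at hle
    · intro u hu
      simp only [List.mem_cons, List.not_mem_nil, or_false] at hu
      rcases hu with rfl | rfl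
      · exact h1
      · exact h2
    · simp only [List.isChain_cons_cons, List.isChain_singleton, and_true, Link, true_and]
      refine ⟨fun _ => ?_, fun h => absurd trivial (by simp at h)⟩
      rcases hdc with rfl | hdc
      · exact Or.inl (Or.inr hc)
      · exact Or.inr ⟨c, Or.inr hc, hdc⟩
  · have hkZ := hnon hc
    refine ⟨fun hk => ?_, fun h => absurd h hc⟩
    rcases hk with hk | hk
    · exact hno (genGraph_edge_of_mem_marg hk hne hc hs ht)
    · exact hkZ (Or.inl hk)

theorem exists_connects_alphaAG (hH : H.IsAG) (hC₁ : C₁ ⊆ H.nodes) (hA : A ⊆ H.nodes \ (M ∪ C))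
    (hB : B ⊆ H.nodes \ (M ∪ C)) (hAB : Disjoint A B) (hCC₁ : Disjoint C C₁)
    (hC₁M : Disjoint C₁ M) (hw : Connects H H (C ∪ C₁) A B w) :
    ∃ w', Connects H (alphaAG H M C) (C ∪ C₁) A B w' := by
  have hw₁ : Connects H (genGraph H M C) (C ∪ C₁) A B w :=
    ⟨hw.ne_nil, fun s hs => genGraph_edge_of_edge (hw.valid s hs), hw.chain, hw.head, hw.last⟩
  obtain ⟨w₁, hw₁⟩ := hw₁.exists_shortest M
  have hmem := hw₁.1.forall_mem hA hB fun {l₁ l₂ s t} h =>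
    ⟨(genGraph_mem_nodes hH (hw₁.1.valid s (by simp [h]))).2,
      (hw₁.inner_notMem_of_genGraph hH hC₁ hAB hCC₁ hC₁M h).1⟩
  have hw₂ : Connects H (ag2 (alphaSG H M C)) (C ∪ C₁) A B _ :=
    hw₁.1.dehead (P := fun i _ => i ∈ H.anSet C)
      (fun {s a b} hs ha hb => ag2_edge_of_alphaSG
        (alphaSG_edge_of_genGraph (hw₁.1.valid s hs) (hmem s hs).1 (hmem s hs).2 ha hb))
      fun {l₁ l₂ s t} h hst h1 h2 => by
        have := (hw₁.inner_notMem_of_genGraph hH hC₁ hAB hCC₁ hC₁M h).2 ⟨h1, h2⟩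
        exact ⟨this, hst ▸ this⟩
  obtain ⟨w₂, hw₂⟩ := hw₂.exists_shortest ∅
  refine ⟨_, hw₂.1.dehead (P := AG3Anc (ag2 (alphaSG H M C)))
    (fun {s a b} hs ha hb => alphaAG_edge_of_ag2 hH (hw₂.1.valid s hs) ha hb) ?_⟩
  intro l₁ l₂ s t h hst hs' ht'
  have hne : s.src ≠ t.tgt := hw₂.src_ne_tgt hH.acyclic Set.subset_union_left
    (ag2_compatible hH) hAB (l₁ := l₁) (l₂ := [s, t]) (l₃ := l₂) (by simpa using h)
    (by simp) (by simp)
  have hno := hw₂.not_edge h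
  have hs : (ag2 (alphaSG H M C)).edge s.src s.hs s.tgt s.ht := hw₂.1.valid s (by simp [h])
  have ht : (ag2 (alphaSG H M C)).edge t.src t.hs t.tgt t.ht := hw₂.1.valid t (by simp [h])
  have hsymm := @(ag2_compatible (M := M) (C := C) hH).symm
  rw [hs', hst] at hs
  rw [ht'] at ht
  rw [hst]
  exact ⟨fun hk => hno (ag2_edge_of_ag2Anc hH hne hs ht hk.ag2Anc),
    fun hk => hno (hsymm (ag2_edge_of_ag2Anc hH hne.symm (hsymm ht) (hsymm hs) hk.ag2Anc))⟩

end Transfer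
/-- (Theorem 6) Graphs generated by `α_AG` induce the
marginal and conditional independence model: for an ancestral graph `H` and
pairwise disjoint subsets `A`, `B`, `C`, `C₁`, `M` of its node set,
`A ⊥_m B | C₁` holds in `α_AG(H;M,C)` iff `A ⊥_m B | C ∪ C₁` holds in `H`. -/
theorem stmt_19 {V : Type} (H : MixedGraph V) (A B C C₁ M : Set V)
    (hH : H.IsAG)
    (hA : A ⊆ H.nodes) (hB : B ⊆ H.nodes) (hC : C ⊆ H.nodes)
    (hC₁ : C₁ ⊆ H.nodes) (hM : M ⊆ H.nodes)
    (hAB : Disjoint A B) (hAC : Disjoint A C) (hAC₁ : Disjoint A C₁)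
    (hAM : Disjoint A M) (hBC : Disjoint B C) (hBC₁ : Disjoint B C₁)
    (hBM : Disjoint B M) (hCC₁ : Disjoint C C₁) (hCM : Disjoint C M)
    (hC₁M : Disjoint C₁ M) :
    MSep (alphaAG H M C) A B C₁ ↔ MSep H A B (C ∪ C₁) := by
  have hnode : ∀ {D : Set V}, D ⊆ H.nodes → Disjoint D M → Disjoint D C →
      D ⊆ H.nodes \ (M ∪ C) := fun h h₁ h₂ x hx =>
    ⟨h hx, not_or.2 ⟨h₁.notMem_of_mem_left hx, h₂.notMem_of_mem_left hx⟩⟩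
  have hA' := hnode hA hAM hAC
  have hB' := hnode hB hBM hBC
  have hC₁' := hnode hC₁ hC₁M hCC₁.symm
  have hCZ : C ⊆ C ∪ C₁ := Set.subset_union_left
  constructor
  · intro hsep i hi j hj w hp hm
    obtain ⟨w, hw⟩ := exists_connects_alphaAG hH hC₁ hA' hB' hAB hCC₁ hC₁M
      (Connects.of_isPath hp hm hi hj (fun x hx h => hx.2 (Or.inr h)) fun _ h => h)
    obtain ⟨w, hw⟩ := hw.exists_shortest ∅
    refine not_mSep_of_shortest hH.acyclic hCZ (alphaAG_compatible hH) hAB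
      Set.subset_union_right (fun h => (alphaAG_ancestralEdge hH h).mem_right) ?_ hw hsep
    intro i a k h hk
    have he := alphaAG_ancestralEdge hH h
    have hkC : k ∉ C := fun h => he.mem_right.2 (Or.inr h)
    have hkC' : k ∉ H.anSet C := he.head_right rfl
    rw [anSet_union] at hk
    have hk' : k ∈ C₁ ∨ k ∈ H.anSet C₁ := by
      simp only [Set.mem_union] at hk
      tauto
    refine hk'.imp id fun ⟨c, hc, hkc⟩ => ⟨c, hc, ?_⟩
    obtain ⟨d, hd, hgen, hkd, -, hdc⟩ := exists_genArrow_of_anc hH (hC₁' hc) hkc hkC'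
    have harrow := alphaAG_arrow_of_genArrow hgen he.mem_right hd fun h => hkC' (hkd.anSet h)
    rcases hdc with rfl | hdc
    · exact .single harrow
    · exact .head harrow hdc
  · intro hsep i hi j hj w hp hm
    have hw : Connects H (alphaAG H M C) (C ∪ C₁) A B w := by
      refine Connects.of_isPath hp hm hi hj (fun x hx h => ?_) fun {i a k} h hk => ?_
      · exact h.elim (fun h => hx.1.2 (Or.inr h)) fun h => hx.2 (Or.inr h)
      · refine hk.elim (fun hk => Or.inl (Or.inr hk)) fun ⟨c, hc, hkc⟩ => Or.inr ?_
        rw [anSet_union]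
        exact (alphaAG_tailRel_of_anc hH hkc ((alphaAG_ancestralEdge hH h).hasHead hH)).elim
          (fun h => Or.inr ⟨c, hc, h⟩) Or.inl
    obtain ⟨x, hx, y, hy, a, b, hr⟩ := hw.exists_reach hH.acyclic (hH.compatible C) hCZ
      (Set.disjoint_union_right.2 ⟨hCM.symm, hC₁M.symm⟩) (alphaAG_compatible hH)
      (fun h => (alphaAG_ancestralEdge hH h).represented)
    obtain ⟨a, b, hr⟩ := hr.of_relaxed hH.edge_symm
    obtain ⟨w, hw⟩ := hr.exists_connects hx hy
    obtain ⟨w, hw⟩ := hw.exists_shortest ∅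
    refine not_mSep_of_shortest hH.acyclic hCZ (hH.compatible C) hAB le_rfl (fun {i a j b} h => ?_)
      (fun _ h => h) hw hsep
    exact (genGraph_mem_nodes hH (genGraph_edge_of_edge (M := ∅) (C := ∅) h)).2

end StableMixedGraphs
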